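/- Let φ > 0 and consider the time-dependent Hamiltonian on (ℝ²∖{0}) × ℝ² given by H(s, q, p) = (1/2)|p − a(s, q)|², where a(s, q) = (1/2 − φ s/|q|²) q^⊥ and q^⊥ = (−q₂, q₁). Let (q, p) : ℝ → (ℝ²∖{0}) × ℝ² be a global differentiable solution of Hamilton's equations q′(s) = ∇_p H(s, q(s), p(s)), p′(s) = −∇_q H(s, q(s), p(s)). Then |q(s)|/√|s| → √(2φ) as s → −∞; i.e., in the past the distance of the particle from the puncture grows like √(2φ|s|). -/

import Mathlib

open MeasureTheory Filter Topology

noncomputable section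

/-- The plane `ℝ²` with its Euclidean inner product structure. -/
abbrev Plane : Type := EuclideanSpace ℝ (Fin 2)

/-- Rotation by `π/2`: `q^⊥ = (-q₂, q₁)`. -/
def perp (q : Plane) : Plane := !₂[-(q 1), q 0]

/-- The time-dependent vector potential `a(s,q) = (1/2 - φ s / |q|²) q^⊥`. -/
def vecPot (φ s : ℝ) (q : Plane) : Plane := ((1 : ℝ)/2 - φ * s / ‖q‖^2) • perp q

/-- The time-dependent Hamiltonian `H(s,q,p) = (1/2)|p - a(s,q)|²`. -/
def Ham (φ s : ℝ) (q p : Plane) : ℝ := (1/2) * ‖p - vecPot φ s q‖^2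

/-- Hamilton's equations `q' = ∇_p H`, `p' = -∇_q H` hold at time `s`. -/
def HamiltonEqnsAt (φ : ℝ) (q p : ℝ → Plane) (s : ℝ) : Prop :=
  HasDerivAt q (gradient (fun y => Ham φ s (q s) y) (p s)) s ∧
    HasDerivAt p (-(gradient (fun x => Ham φ s x (p s)) (q s))) s

lemma norm_sq_plane (x : Plane) : ‖x‖ ^ 2 = x 0 ^ 2 + x 1 ^ 2 := by
  rw [EuclideanSpace.real_norm_sq_eq, Fin.sum_univ_two]

lemma Ham_eq (φ s : ℝ) (x y : Plane) : Ham φ s x y =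
    (1/2) * ((y 0 + (1/2 - φ * s / (x 0 ^ 2 + x 1 ^ 2)) * x 1) ^ 2 +
      (y 1 - (1/2 - φ * s / (x 0 ^ 2 + x 1 ^ 2)) * x 0) ^ 2) := by
  unfold Ham vecPot perp
  rw [norm_sq_plane, norm_sq_plane]
  simp

lemma hasFDerivAt_coord (i : Fin 2) (x : Plane) :
    HasFDerivAt (fun y : Plane => y i) (EuclideanSpace.proj i : Plane →L[ℝ] ℝ) x :=
  (EuclideanSpace.proj i : Plane →L[ℝ] ℝ).hasFDerivAt

lemma gradient_p (φ s : ℝ) (x y : Plane) :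
    gradient (fun y => Ham φ s x y) y =
      !₂[y 0 + (1/2 - φ * s / (x 0 ^ 2 + x 1 ^ 2)) * x 1,
        y 1 - (1/2 - φ * s / (x 0 ^ 2 + x 1 ^ 2)) * x 0] := by
  apply HasGradientAt.gradient
  rw [hasGradientAt_iff_hasFDerivAt]
  simp only [Ham_eq]
  have h0 := hasFDerivAt_coord 0 y
  have h1 := hasFDerivAt_coord 1 y
  have := (((h0.add_const ((1/2 - φ * s / (x 0 ^ 2 + x 1 ^ 2)) * x 1)).pow 2).add
    ((h1.sub_const ((1/2 - φ * s / (x 0 ^ 2 + x 1 ^ 2)) * x 0)).pow 2)).const_mul (1/2)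
  refine this.congr_fderiv ?_
  ext v
  simp [EuclideanSpace.inner_eq_star_dotProduct, dotProduct, Fin.sum_univ_two]
  ring

lemma gradient_q (φ s : ℝ) (x y : Plane) (hx : x 0 ^ 2 + x 1 ^ 2 ≠ 0) :
    gradient (fun x => Ham φ s x y) x =
      !₂[(y 0 + (1/2 - φ * s / (x 0 ^ 2 + x 1 ^ 2)) * x 1) *
            (x 1 * (2 * φ * s * x 0 / (x 0 ^ 2 + x 1 ^ 2) ^ 2))
          - (y 1 - (1/2 - φ * s / (x 0 ^ 2 + x 1 ^ 2)) * x 0) *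
            ((1/2 - φ * s / (x 0 ^ 2 + x 1 ^ 2))
              + x 0 * (2 * φ * s * x 0 / (x 0 ^ 2 + x 1 ^ 2) ^ 2)),
        (y 0 + (1/2 - φ * s / (x 0 ^ 2 + x 1 ^ 2)) * x 1) *
            ((1/2 - φ * s / (x 0 ^ 2 + x 1 ^ 2))
              + x 1 * (2 * φ * s * x 1 / (x 0 ^ 2 + x 1 ^ 2) ^ 2))
          - (y 1 - (1/2 - φ * s / (x 0 ^ 2 + x 1 ^ 2)) * x 0) *
            (x 0 * (2 * φ * s * x 1 / (x 0 ^ 2 + x 1 ^ 2) ^ 2))] := by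
  apply HasGradientAt.gradient
  rw [hasGradientAt_iff_hasFDerivAt]
  simp only [Ham_eq]
  have h0 := hasFDerivAt_coord 0 x
  have h1 := hasFDerivAt_coord 1 x
  have hinv := (hasDerivAt_inv hx).comp_hasFDerivAt x ((h0.pow 2).add (h1.pow 2))
  have hg := (hinv.const_mul (φ * s)).const_sub (1/2)
  have := ((((hg.mul h1).const_add (y 0)).pow 2).add
    (((hg.mul h0).const_sub (y 1)).pow 2)).const_mul (1/2)
  refine (this.congr_fderiv ?_).congr_of_eventuallyEq (Eventually.of_forall ?_)
  · ext v
    simp [EuclideanSpace.inner_eq_star_dotProduct, dotProduct, Fin.sum_univ_two]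
    field_simp
    ring
  · intro z
    simp [div_eq_mul_inv]

/-- Scalar core: the reduced radial system, run backwards in time. -/
lemma core (φ m : ℝ) (hφ : 0 < φ) (ρ x K T : ℝ → ℝ) (hT : ∀ t, T t = φ * t + m)
    (hρ : ∀ t, 0 < ρ t) (hρ' : ∀ t, HasDerivAt ρ (2 * x t) t)
    (hx' : ∀ t, HasDerivAt x (K t + T t - ρ t / 2) t)
    (hK : ∀ t, x t ^ 2 + (ρ t / 2 - T t) ^ 2 = K t * ρ t) :
    Tendsto (fun t => ρ t / T t) atTop (𝓝 2) := by
  have hT' : ∀ t, HasDerivAt T φ t := by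
    intro t
    have h : HasDerivAt (fun t => φ * t + m) φ t := by
      simpa using ((hasDerivAt_id t).const_mul φ).add_const m
    exact h.congr_of_eventuallyEq (Eventually.of_forall hT)
  have hTtop : Tendsto T atTop atTop := by
    have : T = fun t => φ * t + m := funext hT
    rw [this]
    exact tendsto_atTop_add_const_right _ _ (tendsto_id.const_mul_atTop hφ)
  have hK0 : ∀ t, 0 ≤ K t := by
    intro t
    have := hρ t
    by_contra! h
    nlinarith [hK t, sq_nonneg (x t), sq_nonneg (ρ t / 2 - T t)]
  have hKeq : K = fun t => (x t ^ 2 + (ρ t / 2 - T t) ^ 2) / ρ t := by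
    funext t
    rw [hK t]; field_simp [(hρ t).ne']
  have hK' : ∀ t, HasDerivAt K (-φ + 2 * φ * T t / ρ t) t := by
    intro t
    have hne := (hρ t).ne'
    have h := (((hx' t).pow 2).add ((((hρ' t).div_const 2).sub (hT' t)).pow 2)).div (hρ' t) hne
    have h2 : HasDerivAt (fun t => (x t ^ 2 + (ρ t / 2 - T t) ^ 2) / ρ t)
      (-φ + 2 * φ * T t / ρ t) t := by
      refine h.congr_deriv ?_
      have hk := hK t
      simp only [Pi.add_apply, Pi.pow_apply, Pi.sub_apply, Nat.cast_ofNat]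
      rw [hk]
      field_simp
      ring
    rw [← hKeq] at h2
    exact h2
  have hsq : ∀ t, x t ^ 2 + (ρ t / 2 + T t) ^ 2 = (K t + 2 * T t) * ρ t := by
    intro t; linear_combination hK t
  let α : ℝ → ℝ := fun t => Real.arctan (x t / (ρ t / 2 + T t))
  have hα' : ∀ t, 0 < T t → HasDerivAt α
      (T t / ρ t - 1/2 - φ * x t / ((K t + 2 * T t) * ρ t)) t := by
    intro t ht
    have hr := hρ t
    have hl : ρ t / 2 + T t ≠ 0 := by positivity
    have hN : K t + 2 * T t ≠ 0 := by have := hK0 t; positivity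
    have h := ((hx' t).div (((hρ' t).div_const 2).add (hT' t)) hl).arctan
    refine h.congr_deriv ?_
    simp only [Pi.add_apply, Pi.div_apply]
    have e : 1 + (x t / (ρ t / 2 + T t)) ^ 2 = (K t + 2 * T t) * ρ t / (ρ t / 2 + T t) ^ 2 := by
      rw [← hsq t]; field_simp; ring
    rw [e]
    have hr' := hr.ne'
    field_simp
    linear_combination (-4) * hsq t
  have hαb : ∀ t, |α t| ≤ 2 := by
    intro t
    have h1 := Real.arctan_lt_pi_div_two (x t / (ρ t / 2 + T t))
    have h2 := Real.neg_pi_div_two_lt_arctan (x t / (ρ t / 2 + T t))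
    have h3 := Real.pi_le_four
    rw [abs_le]; constructor <;> simp only [α] <;> linarith
  let U : ℝ → ℝ := fun t => K t - 2 * φ * α t - φ * K t / (2 * T t) + 8 * φ
  let U' : ℝ → ℝ := fun t => (-φ + 2 * φ * T t / ρ t)
      - 2 * φ * (T t / ρ t - 1/2 - φ * x t / ((K t + 2 * T t) * ρ t))
      - (φ * (-φ + 2 * φ * T t / ρ t) * (2 * T t) - φ * K t * (2 * φ)) / (2 * T t) ^ 2
  have hU' : ∀ t, 0 < T t → HasDerivAt U (U' t) t := by
    intro t ht
    exact (((hK' t).sub ((hα' t ht).const_mul (2 * φ))).sub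
      (((hK' t).const_mul φ).div ((hT' t).const_mul 2) (by positivity))).add_const (8 * φ)
  have hUlow : ∀ t, 4 * φ ≤ T t → K t / 2 + 4 * φ ≤ U t := by
    intro t ht
    have h1 := (abs_le.1 (hαb t)).2
    have hTp : 0 < T t := by linarith
    have h2 : φ * K t / (2 * T t) ≤ K t / 2 := by
      rw [div_le_div_iff₀ (by positivity) (by positivity)]
      nlinarith [hK0 t]
    have : φ * α t ≤ φ * 2 := by gcongr
    simp only [U]; linarith
  have hUd : ∀ t, 4 * φ ≤ T t → 2 * U' t * T t ≤ φ * U t := by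
    intro t ht
    have hTp : 0 < T t := by linarith
    have hr := hρ t
    have hk := hK0 t
    have hlow := hUlow t ht
    have hxN : x t ≤ ((K t + 2 * T t) + ρ t) / 2 := by
      have h := hsq t
      refine abs_le_of_sq_le_sq' ?_ (by positivity) |>.2
      nlinarith [sq_nonneg (ρ t / 2 + T t), sq_nonneg (K t + 2 * T t - ρ t)]
    have h1 : x t / ((K t + 2 * T t) * ρ t) ≤ 1 / (2 * ρ t) + 1 / (4 * T t) := by
      calc x t / ((K t + 2 * T t) * ρ t)
          ≤ (((K t + 2 * T t) + ρ t) / 2) / ((K t + 2 * T t) * ρ t) := by gcongr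
        _ = 1 / (2 * ρ t) + 1 / (2 * (K t + 2 * T t)) := by field_simp
        _ ≤ _ := by
          have : 1 / (2 * (K t + 2 * T t)) ≤ 1 / (4 * T t) := by
            apply one_div_le_one_div_of_le (by positivity); linarith
          linarith
    have h2 : U' t ≤ φ ^ 2 / T t + φ ^ 2 * K t / (2 * T t ^ 2) := by
      have e : U' t = 2 * φ ^ 2 * (x t / ((K t + 2 * T t) * ρ t))
        - φ ^ 2 / ρ t + φ ^ 2 / (2 * T t) + φ ^ 2 * K t / (2 * T t ^ 2) := by
        simp only [U']
        have : K t + 2 * T t ≠ 0 := by positivity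
        field_simp
        ring
      have h3 := mul_le_mul_of_nonneg_left h1 (by positivity : 0 ≤ 2 * φ ^ 2)
      have e2 : 2 * φ ^ 2 * (1 / (2 * ρ t) + 1 / (4 * T t)) = φ ^ 2 / ρ t + φ ^ 2 / (2 * T t) := by
        field_simp
        ring
      have e3 : φ ^ 2 / T t = φ ^ 2 / (2 * T t) + φ ^ 2 / (2 * T t) := by field_simp; norm_num
      rw [e, e3]; linarith
    have h4 : 2 * U' t * T t ≤ 2 * φ ^ 2 + φ * (φ * K t / T t) := by
      calc 2 * U' t * T t ≤ 2 * (φ ^ 2 / T t + φ ^ 2 * K t / (2 * T t ^ 2)) * T t := by gcongr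
        _ = _ := by field_simp
    have h5 : φ * K t / T t ≤ K t / 4 := by
      rw [div_le_div_iff₀ (by positivity) (by positivity)]
      nlinarith
    have h6 : φ * (φ * K t / T t) ≤ φ * (K t / 4) := by gcongr
    nlinarith
  obtain ⟨t0, ht0⟩ := (eventually_atTop.1 (hTtop.eventually_ge_atTop (4 * φ)))
  have hanti : AntitoneOn (fun t => U t ^ 2 / T t) (Set.Ici t0) := by
    have hd : ∀ t ∈ Set.Ici t0, HasDerivAt (fun t => U t ^ 2 / T t)
        ((2 * U t * U' t * T t - U t ^ 2 * φ) / T t ^ 2) t := by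
      intro t ht
      have hTp : 0 < T t := by have := ht0 t ht; linarith
      refine (((hU' t hTp).pow 2).div (hT' t) hTp.ne').congr_deriv ?_
      simp
    apply antitoneOn_of_deriv_nonpos (convex_Ici t0)
    · intro t ht; exact (hd t ht).continuousAt.continuousWithinAt
    · intro t ht
      exact (hd t (interior_subset ht)).differentiableAt.differentiableWithinAt
    · intro t ht
      have ht := interior_subset ht
      rw [(hd t ht).deriv]
      apply div_nonpos_of_nonpos_of_nonneg _ (by positivity)
      have h1 := hUd t (ht0 t ht)
      have h2 := hUlow t (ht0 t ht)
      have h3 := hK0 t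
      have : 0 ≤ U t := by linarith
      nlinarith
  set C := U t0 ^ 2 / T t0 with hC
  have hk2 : ∀ t, t0 ≤ t → (K t / T t) ^ 2 ≤ 4 * C / T t := by
    intro t ht
    have h1 : U t ^ 2 / T t ≤ C := hanti (Set.self_mem_Ici) ht ht
    have hTp : 0 < T t := by have := ht0 t ht; linarith
    have h2 := hUlow t (ht0 t ht)
    have h3 := hK0 t
    have h4 : K t ^ 2 ≤ 4 * U t ^ 2 := by nlinarith
    rw [div_le_iff₀ hTp] at h1
    rw [div_pow, div_le_div_iff₀ (by positivity) hTp]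
    nlinarith [mul_le_mul_of_nonneg_right (h4.trans (mul_le_mul_of_nonneg_left h1 (by norm_num))) hTp.le]
  have hlim2 : Tendsto (fun t => (K t / T t) ^ 2) atTop (𝓝 0) := by
    refine squeeze_zero' (Eventually.of_forall fun t => sq_nonneg _)
      ((eventually_ge_atTop t0).mono hk2) ?_
    exact tendsto_const_nhds.div_atTop hTtop
  have hlim : Tendsto (fun t => K t / T t) atTop (𝓝 0) := by
    have h := hlim2.sqrt
    simp only [Real.sqrt_sq_eq_abs, Real.sqrt_zero] at h
    exact (tendsto_zero_iff_abs_tendsto_zero _).2 h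
  have hr2 : Tendsto (fun t => (ρ t / T t - 2) ^ 2) atTop (𝓝 0) := by
    have hb : Tendsto (fun t => 16 * (K t / T t) ^ 2 + 16 * (K t / T t)) atTop (𝓝 0) := by
      simpa using (hlim2.const_mul 16).add (hlim.const_mul 16)
    refine squeeze_zero' (Eventually.of_forall fun t => sq_nonneg _)
      ((eventually_ge_atTop t0).mono fun t ht => ?_) hb
    have hTp : 0 < T t := by have := ht0 t ht; linarith
    have h1 : (ρ t / T t - 2) ^ 2 ≤ 4 * (K t / T t) * (ρ t / T t) := by
      have e1 : (ρ t / T t - 2) ^ 2 = 4 * (ρ t / 2 - T t) ^ 2 / T t ^ 2 := by field_simp; ring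
      have e2 : 4 * (K t / T t) * (ρ t / T t) = 4 * (K t * ρ t) / T t ^ 2 := by field_simp
      rw [e1, e2, ← hK t]
      gcongr
      nlinarith [sq_nonneg (x t)]
    nlinarith [sq_nonneg (ρ t / T t - 2 - 4 * (K t / T t))]
  have hr1 : Tendsto (fun t => ρ t / T t - 2) atTop (𝓝 0) := by
    have h := hr2.sqrt
    simp only [Real.sqrt_sq_eq_abs, Real.sqrt_zero] at h
    exact (tendsto_zero_iff_abs_tendsto_zero _).2 h
  simpa using hr1.add_const 2

lemma hasDerivAt_coord {f : ℝ → Plane} {f' : Plane} {s : ℝ} (h : HasDerivAt f f' s) (i : Fin 2) :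
    HasDerivAt (fun s => f s i) (f' i) s :=
  (hasFDerivAt_coord i (f s)).comp_hasDerivAt s h

/-- Along any global solution of Hamilton's equations, the distance
from the puncture grows like `√(2φ|s|)` in the past: `|q(s)|/√|s| → √(2φ)` as `s → -∞`. -/
theorem radius_growth_past (φ : ℝ) (hφ : 0 < φ)
    (q p : ℝ → Plane)
    (hq0 : ∀ s, q s ≠ 0)
    (hham : ∀ s, HamiltonEqnsAt φ q p s) :
    Tendsto (fun s => ‖q s‖ / Real.sqrt |s|) atBot (𝓝 (Real.sqrt (2 * φ))) := by
  have hpos : ∀ s, 0 < q s 0 ^ 2 + q s 1 ^ 2 := by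
    intro s
    rw [← norm_sq_plane]
    have := norm_pos_iff.2 (hq0 s)
    positivity
  let R : ℝ → ℝ := fun s => q s 0 ^ 2 + q s 1 ^ 2
  let X : ℝ → ℝ := fun s => q s 0 * p s 0 + q s 1 * p s 1
  let L : ℝ → ℝ := fun s => q s 0 * p s 1 - q s 1 * p s 0
  have key : ∀ s, HasDerivAt R (2 * X s) s ∧ HasDerivAt L 0 s ∧
      HasDerivAt X ((X s ^ 2 + (φ * s + L s + R s / 2) ^ 2) / R s - (φ * s + L s) - R s / 2) s := by
    intro s
    obtain ⟨hq, hp⟩ := hham s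
    have hne := (hpos s).ne'
    rw [gradient_p] at hq
    rw [gradient_q _ _ _ _ hne] at hp
    have q0 := hasDerivAt_coord hq 0
    have q1 := hasDerivAt_coord hq 1
    have p0 := hasDerivAt_coord hp 0
    have p1 := hasDerivAt_coord hp 1
    simp only [PiLp.neg_apply, PiLp.toLp_apply, Matrix.cons_val_zero, Matrix.cons_val_one] at q0 q1 p0 p1
    refine ⟨((q0.pow 2).add (q1.pow 2)).congr_deriv ?_,
      ((q0.mul p1).sub (q1.mul p0)).congr_deriv ?_,
      ((q0.mul p0).add (q1.mul p1)).congr_deriv ?_⟩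
    · simp only [X]; push_cast; ring
    · field_simp
      ring
    · simp only [X, L, R]
      field_simp
      ring
  have hL : ∀ s, L s = L 0 := fun s =>
    is_const_of_deriv_eq_zero (fun s => (key s).2.1.differentiableAt) (fun s => (key s).2.1.deriv) s 0
  have hc := core φ (-L 0) hφ (fun t => R (-t)) (fun t => -X (-t))
    (fun t => (X (-t) ^ 2 + (R (-t) / 2 - (φ * t + -L 0)) ^ 2) / R (-t))
    (fun t => φ * t + -L 0) (fun t => rfl) (fun t => hpos (-t))
    (fun t => by
      refine ((key (-t)).1.scomp t (hasDerivAt_neg t)).congr_deriv ?_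
      simp)
    (fun t => by
      refine (((key (-t)).2.2.scomp t (hasDerivAt_neg t)).neg).congr_deriv ?_
      rw [hL (-t)]
      simp only [smul_eq_mul]
      ring)
    (fun t => by
      have : R (-t) ≠ 0 := (hpos (-t)).ne'
      field_simp)
  have hTt : Tendsto (fun t : ℝ => (φ * t + -L 0) / t) atTop (𝓝 φ) := by
    have h : Tendsto (fun t : ℝ => φ + (-L 0) / t) atTop (𝓝 (φ + 0)) :=
      tendsto_const_nhds.add (tendsto_const_nhds.div_atTop tendsto_id)
    rw [add_zero] at h
    refine h.congr' ?_
    filter_upwards [eventually_gt_atTop 0] with t ht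
    field_simp
  have hRt : Tendsto (fun t : ℝ => R (-t) / t) atTop (𝓝 (2 * φ)) := by
    refine (hc.mul hTt).congr' ?_
    have hTtop : Tendsto (fun t : ℝ => φ * t + -L 0) atTop atTop :=
      tendsto_atTop_add_const_right _ _ (tendsto_id.const_mul_atTop hφ)
    filter_upwards [hTtop.eventually_gt_atTop 0] with t ht
    exact div_mul_div_cancel₀ ht.ne'
  have h := (hRt.sqrt).comp tendsto_neg_atBot_atTop
  refine h.congr' ?_
  filter_upwards [eventually_lt_atBot 0] with s hs
  simp only [Function.comp, neg_neg]
  rw [abs_of_neg hs, Real.sqrt_div (hpos s).le]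
  simp only [R]
  rw [← norm_sq_plane, Real.sqrt_sq (norm_nonneg _)]
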